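/- Let f : ℝ × ℝ → ℝ be C^∞ and let u be a C^∞ solution of u'(t) = f(t, u(t)) on [a,b]. Fix t ∈ [a,b), write f, f_t, f_u, f_tu, f_uu, f_uuu, f_tuu, f_ttu, f_ttt for f and its partial derivatives evaluated at (t, u(t)) and write v = u(t). Take the three-stage IMQ-RBF Runge–Kutta method with a₂₁ = c₂ = 1/2, a₃₁ = 0, a₃₂ = c₃ = 3/4, b₁ = 2/9, b₂ = 1/3, b₃ = 4/9, and shape parameters ε₂² = ((1/3)f³·f_uuu + f²·f_tuu + 4f·f_u³ + f·f_ttu + 4f_t·f_u² + (1/3)f_ttt)/(v·f·f_uu − 4v·f_u² + v·f_tu − f·f_u) and ε₃² = −ε₂²/3, assuming the denominator v·f·f_uu − 4v·f_u² + v·f_tu − f·f_u is nonzero. Then the local truncation error τ(t,h) satisfies τ(t,h) = O(h⁴) as h → 0⁺; that is, there exist C > 0 and h₀ > 0 such that |τ(t,h)| ≤ C h⁴ for all 0 < h ≤ h₀ (so the method is fourth-order accurate). -/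

import Mathlib

/-- Directional (partial) derivative of `f : ℝ × ℝ → ℝ` in the direction `d`;
`pd f (1,0) = f_t`, `pd f (0,1) = f_u`, and iterates give higher partials. -/
noncomputable def pd (f : ℝ × ℝ → ℝ) (d : ℝ × ℝ) : ℝ × ℝ → ℝ :=
  fun p => fderiv ℝ f p d

open Asymptotics Filter Topology Set

section Partial

variable {f : ℝ × ℝ → ℝ}

theorem contDiff_pd (hf : ContDiff ℝ (⊤ : ℕ∞) f) (d : ℝ × ℝ) :
    ContDiff ℝ (⊤ : ℕ∞) (pd f d) :=
  (hf.fderiv_right (m := (⊤ : ℕ∞)) (by norm_cast)).clm_apply contDiff_const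

theorem pd_comm (hf : ContDiff ℝ (⊤ : ℕ∞) f) (d e : ℝ × ℝ) :
    pd (pd f d) e = pd (pd f e) d := by
  funext p
  have hd : DifferentiableAt ℝ (fderiv ℝ f) p :=
    ((hf.fderiv_right (m := (⊤ : ℕ∞)) (by norm_cast)).differentiable (by simp)) p
  have hsym : IsSymmSndFDerivAt ℝ f p :=
    hf.contDiffAt.isSymmSndFDerivAt (by
      rw [minSmoothness_of_isRCLikeNormedField]; exact WithTop.coe_le_coe.2 (le_top : (2 : ℕ∞) ≤ ⊤))
  have key (d e : ℝ × ℝ) : pd (pd f d) e p = fderiv ℝ (fderiv ℝ f) p e d := by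
    have h := (hd.hasFDerivAt.clm_apply (hasFDerivAt_const d p)).fderiv
    change fderiv ℝ (fun q => fderiv ℝ f q d) p e = _
    rw [h]
    simp
  rw [key, key]
  exact hsym e d

theorem hasDerivAt_comp_line (hf : ContDiff ℝ (⊤ : ℕ∞) f) (p : ℝ × ℝ) (x y s : ℝ) :
    HasDerivAt (fun s : ℝ => f (p + s • (x, y)))
      (x * pd f (1, 0) (p + s • (x, y)) + y * pd f (0, 1) (p + s • (x, y))) s := by
  have h1 : HasDerivAt (fun s : ℝ => p + s • (x, y)) (x, y) s := by
    simpa using ((hasDerivAt_id s).smul_const (x, y)).const_add p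
  have h2 := ((hf.differentiable (by simp)) (p + s • (x, y))).hasFDerivAt.comp_hasDerivAt s h1
  refine h2.congr_deriv ?_
  have hxy : ((x, y) : ℝ × ℝ) = x • (1, 0) + y • (0, 1) := by simp
  change _ = x * fderiv ℝ f _ (1, 0) + y * fderiv ℝ f _ (0, 1)
  generalize fderiv ℝ f (p + s • (x, y)) = L
  rw [hxy, map_add, map_smul, map_smul, smul_eq_mul, smul_eq_mul]

/-- The third-order Taylor polynomial of `f` at `p`, in the increments `x`, `y`. -/
noncomputable def taylorCubic (f : ℝ × ℝ → ℝ) (p : ℝ × ℝ) (x y : ℝ) : ℝ :=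
  f p + (x * pd f (1, 0) p + y * pd f (0, 1) p) +
    (x ^ 2 * pd (pd f (1, 0)) (1, 0) p + 2 * x * y * pd (pd f (1, 0)) (0, 1) p +
      y ^ 2 * pd (pd f (0, 1)) (0, 1) p) / 2 +
    (x ^ 3 * pd (pd (pd f (1, 0)) (1, 0)) (1, 0) p +
      3 * x ^ 2 * y * pd (pd (pd f (1, 0)) (1, 0)) (0, 1) p +
      3 * x * y ^ 2 * pd (pd (pd f (1, 0)) (0, 1)) (0, 1) p +
      y ^ 3 * pd (pd (pd f (0, 1)) (0, 1)) (0, 1) p) / 6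

/-- The derivative of `f` along `(x, y)` as a combination of partial derivatives. -/
noncomputable def lineDer (x y : ℝ) (f : ℝ × ℝ → ℝ) : ℝ × ℝ → ℝ :=
  fun q => x * pd f (1, 0) q + y * pd f (0, 1) q

theorem contDiff_lineDer (hf : ContDiff ℝ (⊤ : ℕ∞) f) (x y : ℝ) :
    ContDiff ℝ (⊤ : ℕ∞) (lineDer x y f) :=
  (contDiff_const.mul (contDiff_pd hf _)).add (contDiff_const.mul (contDiff_pd hf _))

theorem pd_linearComb {g k : ℝ × ℝ → ℝ} (hg : ContDiff ℝ (⊤ : ℕ∞) g)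
    (hk : ContDiff ℝ (⊤ : ℕ∞) k) (x y : ℝ) (d : ℝ × ℝ) :
    pd (fun q => x * g q + y * k q) d = fun q => x * pd g d q + y * pd k d q := by
  funext q
  have h1 := (hg.differentiable (by simp)) q
  have h2 := (hk.differentiable (by simp)) q
  have h := ((h1.hasFDerivAt.const_mul x).add (h2.hasFDerivAt.const_mul y)).fderiv
  change fderiv ℝ (fun q => x * g q + y * k q) q = _ at h
  change fderiv ℝ (fun q => x * g q + y * k q) q d = _
  rw [h]
  simp [pd]

theorem lineDer_linearComb {g k : ℝ × ℝ → ℝ} (hg : ContDiff ℝ (⊤ : ℕ∞) g)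
    (hk : ContDiff ℝ (⊤ : ℕ∞) k) (x y a b : ℝ) :
    lineDer x y (fun q => a * g q + b * k q) =
      fun q => a * lineDer x y g q + b * lineDer x y k q := by
  funext q
  simp only [lineDer, pd_linearComb hg hk]
  ring

theorem lineDer_succ (hf : ContDiff ℝ (⊤ : ℕ∞) f) (x y : ℝ) (n : ℕ) :
    (lineDer x y)^[n + 1] f = fun q =>
      x * (lineDer x y)^[n] (pd f (1, 0)) q + y * (lineDer x y)^[n] (pd f (0, 1)) q := by
  have hs (n : ℕ) {g : ℝ × ℝ → ℝ} (hg : ContDiff ℝ (⊤ : ℕ∞) g) :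
      ContDiff ℝ (⊤ : ℕ∞) ((lineDer x y)^[n] g) := by
    induction n with
    | zero => exact hg
    | succ n ih => rw [Function.iterate_succ_apply']; exact contDiff_lineDer ih x y
  induction n with
  | zero => rfl
  | succ n ih =>
    rw [Function.iterate_succ_apply', ih,
      lineDer_linearComb (hs n (contDiff_pd hf _)) (hs n (contDiff_pd hf _))]
    simp only [Function.iterate_succ_apply']

theorem exists_iterate_lineDer_le (hf : ContDiff ℝ (⊤ : ℕ∞) f) {K : Set (ℝ × ℝ)}
    (hK : IsCompact K) (n : ℕ) :
    ∃ M, 0 ≤ M ∧ ∀ x y, ∀ q ∈ K,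
      |(lineDer x y)^[n] f q| ≤ M * (|x| + |y|) ^ n := by
  induction n generalizing f with
  | zero =>
    obtain ⟨M, hM⟩ := hK.exists_bound_of_continuousOn hf.continuous.continuousOn
    refine ⟨max M 0, le_max_right _ _, fun x y q hq => ?_⟩
    simpa using Or.inl (hM q hq)
  | succ n ih =>
    obtain ⟨M, hM0, hM⟩ := ih (contDiff_pd hf (1, 0))
    obtain ⟨N, hN0, hN⟩ := ih (contDiff_pd hf (0, 1))
    refine ⟨M + N, by positivity, fun x y q hq => ?_⟩
    rw [lineDer_succ hf]
    calc _ ≤ |x| * (M * (|x| + |y|) ^ n) + |y| * (N * (|x| + |y|) ^ n) := by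
          refine (abs_add_le _ _).trans ?_
          rw [abs_mul, abs_mul]
          gcongr
          exacts [hM x y q hq, hN x y q hq]
      _ ≤ (|x| + |y|) * (M * (|x| + |y|) ^ n) + (|x| + |y|) * (N * (|x| + |y|) ^ n) := by
          gcongr <;> linarith [abs_nonneg x, abs_nonneg y]
      _ = _ := by ring

end Partial

theorem abs_le_of_deriv_le {g g' : ℝ → ℝ} {δ C : ℝ} {n : ℕ} (hC : 0 ≤ C)
    (hg : ∀ s ∈ Icc 0 δ, HasDerivWithinAt g (g' s) (Icc 0 δ) s) (g0 : g 0 = 0)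
    (hb : ∀ s ∈ Icc 0 δ, |g' s| ≤ C * s ^ n) :
    ∀ s ∈ Icc 0 δ, |g s| ≤ C * s ^ (n + 1) := by
  intro s hs
  have hsub : Icc 0 s ⊆ Icc 0 δ := Icc_subset_Icc_right hs.2
  have := (convex_Icc 0 s).norm_image_sub_le_of_norm_hasDerivWithin_le (f := g) (f' := g')
    (C := C * s ^ n) (x := 0) (y := s) (fun r hr => (hg r (hsub hr)).mono hsub)
    (fun r hr => (hb r (hsub hr)).trans (by have := hr.1; have := hr.2; gcongr))
    ⟨le_rfl, hs.1⟩ ⟨hs.1, le_rfl⟩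
  rw [g0, sub_zero, sub_zero, Real.norm_eq_abs, Real.norm_eq_abs, abs_of_nonneg hs.1] at this
  rw [pow_succ, ← mul_assoc]
  exact this

theorem abs_sub_taylor_le {φ : ℕ → ℝ → ℝ} {M : ℝ} (hM : 0 ≤ M)
    (hφ : ∀ n s, HasDerivAt (φ n) (φ (n + 1) s) s) (hb : ∀ s ∈ Icc (0 : ℝ) 1, |φ 4 s| ≤ M) :
    |φ 0 1 - (φ 0 0 + φ 1 0 + φ 2 0 / 2 + φ 3 0 / 6)| ≤ M := by
  have h3 := abs_le_of_deriv_le (n := 0) (δ := 1) (g := fun s => φ 3 s - φ 3 0) (g' := φ 4) hM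
    (fun s _ => ((hφ 3 s).sub_const _).hasDerivWithinAt) (by simp) (by simpa using hb)
  have h2 := abs_le_of_deriv_le (δ := 1) (g := fun s => φ 2 s - (φ 2 0 + φ 3 0 * s))
    (g' := fun s => φ 3 s - φ 3 0) hM
    (fun s _ => by
      have := (hφ 2 s).sub (((hasDerivAt_id s).const_mul (φ 3 0)).const_add (φ 2 0))
      refine (this.congr_deriv ?_).hasDerivWithinAt
      simp) (by simp) h3
  have h1 := abs_le_of_deriv_le (δ := 1)
    (g := fun s => φ 1 s - (φ 1 0 + (φ 2 0 * s + φ 3 0 / 2 * s ^ 2)))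
    (g' := fun s => φ 2 s - (φ 2 0 + φ 3 0 * s)) hM
    (fun s _ => by
      have := (hφ 1 s).sub ((((hasDerivAt_id s).const_mul (φ 2 0)).add
        ((hasDerivAt_pow 2 s).const_mul (φ 3 0 / 2))).const_add (φ 1 0))
      refine (this.congr_deriv ?_).hasDerivWithinAt
      simp; ring) (by simp) h2
  have h0 := abs_le_of_deriv_le (δ := 1)
    (g := fun s => φ 0 s - (φ 0 0 + (φ 1 0 * s + φ 2 0 / 2 * s ^ 2 + φ 3 0 / 6 * s ^ 3)))
    (g' := fun s => φ 1 s - (φ 1 0 + (φ 2 0 * s + φ 3 0 / 2 * s ^ 2))) hM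
    (fun s _ => by
      have := (hφ 0 s).sub (((((hasDerivAt_id s).const_mul (φ 1 0)).add
        ((hasDerivAt_pow 2 s).const_mul (φ 2 0 / 2))).add
        ((hasDerivAt_pow 3 s).const_mul (φ 3 0 / 6))).const_add (φ 0 0))
      refine (this.congr_deriv ?_).hasDerivWithinAt
      simp; ring) (by simp) h1
  have := h0 1 (by simp)
  simp only [mul_one, one_pow] at this
  convert this using 2
  ring

theorem exists_abs_sub_taylorCubic_le {f : ℝ × ℝ → ℝ} (hf : ContDiff ℝ (⊤ : ℕ∞) f) (p : ℝ × ℝ) :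
    ∃ M, 0 ≤ M ∧ ∀ x y, |x| ≤ 1 → |y| ≤ 1 →
      |f (p + (x, y)) - taylorCubic f p x y| ≤ M * (|x| + |y|) ^ 4 := by
  obtain ⟨M, hM0, hM⟩ := exists_iterate_lineDer_le hf (isCompact_closedBall p 1) 4
  refine ⟨M, hM0, fun x y hx hy => ?_⟩
  have hs (n : ℕ) : ContDiff ℝ (⊤ : ℕ∞) ((lineDer x y)^[n] f) := by
    induction n with
    | zero => exact hf
    | succ n ih => rw [Function.iterate_succ_apply']; exact contDiff_lineDer ih x y
  have key := abs_sub_taylor_le (φ := fun n s => (lineDer x y)^[n] f (p + s • (x, y)))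
    (M := M * (|x| + |y|) ^ 4) (by positivity)
    (fun n s => by
      simp only [Function.iterate_succ_apply']
      exact hasDerivAt_comp_line (hs n) p x y s)
    (fun s hs => hM x y _ (by
      rw [mem_closedBall_iff_norm, add_sub_cancel_left, norm_smul, Real.norm_eq_abs,
        abs_of_nonneg hs.1]
      have : ‖(x, y)‖ ≤ 1 := by
        rw [Prod.norm_def]; exact max_le hx hy
      exact mul_le_one₀ hs.2 (norm_nonneg _) this))
  convert key using 3
  · simp
  · have c1 := pd_comm hf (0, 1) (1, 0)
    have c2 := pd_comm (contDiff_pd hf (1, 0)) (0, 1) (1, 0)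
    have c3 := pd_comm (contDiff_pd hf (0, 1)) (0, 1) (1, 0)
    rw [c1] at c3
    have hc {g : ℝ × ℝ → ℝ} (hg : ContDiff ℝ (⊤ : ℕ∞) g) (d : ℝ × ℝ) := contDiff_pd hg d
    simp only [lineDer_succ _ x y 0, lineDer_succ _ x y 1, lineDer_succ _ x y 2, hf, hc,
      Function.iterate_zero, Function.iterate_one, lineDer, id, zero_smul, add_zero,
      taylorCubic, c1, c2, c3]
    ring

section Expansion

variable {f : ℝ × ℝ → ℝ}

theorem isBigO_pow_of_le {m n : ℕ} (hmn : m ≤ n) :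
    (fun h : ℝ => h ^ n) =O[𝓝[≥] 0] fun h => h ^ m :=
  ((isBigO_refl (fun h : ℝ => h ^ m) (𝓝[≥] 0)).mul
    (((by fun_prop : Continuous fun h : ℝ => h ^ (n - m)).continuousWithinAt (s := Ici 0)
      (x := 0)).isBigO_one ℝ)).congr (fun h => by rw [← pow_add, Nat.add_sub_cancel' hmn])
        (fun h => mul_one _)

theorem isBigO_mul_continuous {r G : ℝ → ℝ} {n : ℕ} {c : ℝ}
    (hr : r =O[𝓝[≥] 0] fun h : ℝ => h ^ n) (hG : Tendsto G (𝓝[≥] 0) (𝓝 c)) :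
    (fun h => r h * G h) =O[𝓝[≥] 0] fun h : ℝ => h ^ n := by
  simpa using hr.mul (hG.isBigO_one ℝ)

/-- Substitution of an expansion of `y` with error `O(h ^ n)` into `f (t + c h, v + y h)`. -/
theorem isBigO_comp_sub_expansion (hf : ContDiff ℝ (⊤ : ℕ∞) f) (t v c : ℝ)
    {y : ℝ → ℝ} {n : ℕ} (hn1 : 1 ≤ n) (hn4 : n ≤ 4) {q₁ q₂ q₃ q₄ : ℝ}
    (hy : (fun h => y h - (q₁ * h + q₂ * h ^ 2 + q₃ * h ^ 3 + q₄ * h ^ 4)) =O[𝓝[≥] 0]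
      fun h : ℝ => h ^ n) :
    (fun h => f (t + c * h, v + y h) -
      (f (t, v) + (c * pd f (1, 0) (t, v) + q₁ * pd f (0, 1) (t, v)) * h +
        (c ^ 2 / 2 * pd (pd f (1, 0)) (1, 0) (t, v) + c * q₁ * pd (pd f (1, 0)) (0, 1) (t, v) +
          q₁ ^ 2 / 2 * pd (pd f (0, 1)) (0, 1) (t, v) + q₂ * pd f (0, 1) (t, v)) * h ^ 2 +
        (c ^ 3 / 6 * pd (pd (pd f (1, 0)) (1, 0)) (1, 0) (t, v) +
          c ^ 2 * q₁ / 2 * pd (pd (pd f (1, 0)) (1, 0)) (0, 1) (t, v) +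
          c * q₁ ^ 2 / 2 * pd (pd (pd f (1, 0)) (0, 1)) (0, 1) (t, v) +
          q₁ ^ 3 / 6 * pd (pd (pd f (0, 1)) (0, 1)) (0, 1) (t, v) +
          c * q₂ * pd (pd f (1, 0)) (0, 1) (t, v) +
          q₁ * q₂ * pd (pd f (0, 1)) (0, 1) (t, v) + q₃ * pd f (0, 1) (t, v)) * h ^ 3))
      =O[𝓝[≥] 0] fun h : ℝ => h ^ n := by
  set r : ℝ → ℝ := fun h => y h - (q₁ * h + q₂ * h ^ 2 + q₃ * h ^ 3 + q₄ * h ^ 4) with hr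
  have h4 := isBigO_pow_of_le hn4
  have hid : (fun h : ℝ => h) =O[𝓝[≥] 0] fun h : ℝ => h := isBigO_refl _ _
  have hid0 : Tendsto (fun h : ℝ => h) (𝓝[≥] 0) (𝓝 0) := tendsto_id.mono_left nhdsWithin_le_nhds
  have hy1 : y =O[𝓝[≥] 0] fun h : ℝ => h := by
    have h1 : r =O[𝓝[≥] 0] fun h : ℝ => h := by
      simpa using hy.trans (isBigO_pow_of_le hn1)
    have h2 : (fun h : ℝ => h * (q₁ + q₂ * h + q₃ * h ^ 2 + q₄ * h ^ 3)) =O[𝓝[≥] 0]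
        fun h : ℝ => h ^ 1 :=
      isBigO_mul_continuous (by simpa using hid)
        ((by fun_prop : Continuous fun h : ℝ =>
          q₁ + q₂ * h + q₃ * h ^ 2 + q₄ * h ^ 3).continuousWithinAt)
    simp only [pow_one] at h2
    refine (h1.add h2).congr_left fun h => ?_
    simp only [hr]; ring
  have hy0 : Tendsto y (𝓝[≥] 0) (𝓝 0) := hy1.trans_tendsto hid0
  have hT : (fun h => f (t + c * h, v + y h) - taylorCubic f (t, v) (c * h) (y h)) =O[𝓝[≥] 0]
      fun h : ℝ => h ^ n := by
    obtain ⟨M, -, hM⟩ := exists_abs_sub_taylorCubic_le hf (t, v)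
    have hb : (fun h => (|c * h| + |y h|) ^ 4) =O[𝓝[≥] 0] fun h : ℝ => h ^ 4 :=
      (((hid.const_mul_left c).abs_left).add hy1.abs_left).pow 4
    refine (IsBigO.of_bound M ?_).trans (hb.trans h4)
    have hc0 : Tendsto (fun h => c * h) (𝓝[≥] 0) (𝓝 0) := by simpa using hid0.const_mul c
    filter_upwards [hc0 (Metric.closedBall_mem_nhds 0 one_pos),
      hy0 (Metric.closedBall_mem_nhds 0 one_pos)] with h h1 h2
    have := hM (c * h) (y h) (by simpa using h1) (by simpa using h2)
    rw [Real.norm_eq_abs, Real.norm_of_nonneg (by positivity)]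
    simpa using this
  unfold taylorCubic at hT
  generalize f (t, v) = F at *
  generalize pd f (1, 0) (t, v) = ft at *
  generalize pd f (0, 1) (t, v) = fu at *
  generalize pd (pd f (1, 0)) (1, 0) (t, v) = ftt at *
  generalize pd (pd f (1, 0)) (0, 1) (t, v) = ftu at *
  generalize pd (pd f (0, 1)) (0, 1) (t, v) = fuu at *
  generalize pd (pd (pd f (1, 0)) (1, 0)) (1, 0) (t, v) = fttt at *
  generalize pd (pd (pd f (1, 0)) (1, 0)) (0, 1) (t, v) = fttu at *
  generalize pd (pd (pd f (1, 0)) (0, 1)) (0, 1) (t, v) = ftuu at *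
  generalize pd (pd (pd f (0, 1)) (0, 1)) (0, 1) (t, v) = fuuu at *
  let G : ℝ × ℝ → ℝ := fun z =>
    let h := z.1
    let q := q₁ * h + q₂ * h ^ 2 + q₃ * h ^ 3 + q₄ * h ^ 4
    fu + c * h * ftu + (z.2 + q) / 2 * fuu + (c * h) ^ 2 / 2 * fttu +
      (c * h) * (z.2 + q) / 2 * ftuu + (z.2 ^ 2 + z.2 * q + q ^ 2) / 6 * fuuu
  have hG : Tendsto (fun h => G (h, y h)) (𝓝[≥] 0) (𝓝 (G (0, 0))) :=
    ((by fun_prop : Continuous G).tendsto (0, 0)).comp (hid0.prodMk_nhds hy0)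
  let R : ℝ → ℝ := fun h =>
    let d := q₂ + q₃ * h + q₄ * h ^ 2
    let s := q₁ + h * d
    q₄ * fu + c * (q₃ + q₄ * h) * ftu + (d ^ 2 + 2 * q₁ * (q₃ + q₄ * h)) / 2 * fuu +
      c ^ 2 / 2 * d * fttu + c / 2 * (d * (s + q₁)) * ftuu +
      (d * (s ^ 2 + s * q₁ + q₁ ^ 2)) / 6 * fuuu
  have hR : Tendsto R (𝓝[≥] 0) (𝓝 (R 0)) :=
    (by fun_prop : Continuous R).continuousWithinAt
  refine ((hT.add (isBigO_mul_continuous hy hG)).add (isBigO_mul_continuous h4 hR)).congr_left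
    fun h => ?_
  simp only [hr, G, R]
  ring

theorem isBigO_of_deriv_isBigO {g g' : ℝ → ℝ} {δ : ℝ} (hδ : 0 < δ) {n : ℕ}
    (hg : ∀ s ∈ Icc 0 δ, HasDerivWithinAt g (g' s) (Icc 0 δ) s) (g0 : g 0 = 0)
    (hO : g' =O[𝓝[≥] 0] fun h : ℝ => h ^ n) :
    g =O[𝓝[≥] 0] fun h : ℝ => h ^ (n + 1) := by
  obtain ⟨C, hC, hb⟩ := hO.exists_nonneg
  obtain ⟨η, hη, hη'⟩ := mem_nhdsGE_iff_exists_Icc_subset.1 hb.bound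
  replace hη : 0 < η := hη
  have hsub : Icc 0 (min δ η) ⊆ Icc 0 δ := Icc_subset_Icc_right (min_le_left _ _)
  have key := abs_le_of_deriv_le hC (fun s hs => (hg s (hsub hs)).mono hsub) g0
    (fun s hs => by
      have := hη' ⟨hs.1, hs.2.trans (min_le_right _ _)⟩
      simpa [abs_of_nonneg hs.1] using this)
  refine IsBigO.of_bound C ?_
  filter_upwards [Icc_mem_nhdsGE (lt_min hδ hη)] with s hs
  simpa [abs_of_nonneg hs.1] using key s hs

theorem isBigO_sub_primitive {w w' : ℝ → ℝ} {δ : ℝ} (hδ : 0 < δ) {n : ℕ}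
    (hw : ∀ s ∈ Icc 0 δ, HasDerivWithinAt w (w' s) (Icc 0 δ) s) (w0 : w 0 = 0)
    {p₀ p₁ p₂ p₃ : ℝ}
    (hO : (fun h => w' h - (p₀ + p₁ * h + p₂ * h ^ 2 + p₃ * h ^ 3)) =O[𝓝[≥] 0]
      fun h : ℝ => h ^ n) :
    (fun h => w h - (p₀ * h + p₁ / 2 * h ^ 2 + p₂ / 3 * h ^ 3 + p₃ / 4 * h ^ 4)) =O[𝓝[≥] 0]
      fun h : ℝ => h ^ (n + 1) := by
  refine isBigO_of_deriv_isBigO hδ (fun s hs => ?_) (by simp [w0]) hO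
  refine ((hw s hs).sub ((((hasDerivAt_id s).const_mul p₀).add
    ((hasDerivAt_pow 2 s).const_mul (p₁ / 2))).add ((hasDerivAt_pow 3 s).const_mul (p₂ / 3))
      |>.add ((hasDerivAt_pow 4 s).const_mul (p₃ / 4))).hasDerivWithinAt).congr_deriv ?_
  simp; ring

theorem abs_sqrt_one_add_sub_le {x : ℝ} (hx : |x| ≤ 1 / 2) :
    |√(1 + x) - (1 + x / 2)| ≤ 3 * x ^ 2 ∧ |1 / √(1 + x) - (1 - x / 2)| ≤ 3 * x ^ 2 := by
  obtain ⟨hx1, hx2⟩ := abs_le.1 hx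
  have hs : √(1 + x) ^ 2 = 1 + x := Real.sq_sqrt (by linarith)
  have hs2 : 1 / 2 ≤ √(1 + x) := Real.le_sqrt_of_sq_le (by linarith)
  generalize √(1 + x) = s at hs hs2
  obtain rfl : x = s ^ 2 - 1 := by linarith
  have hsq : (s - 1) ^ 2 ≤ (s ^ 2 - 1) ^ 2 := by
    have : (s ^ 2 - 1) ^ 2 = (s - 1) ^ 2 * (s + 1) ^ 2 := by ring
    rw [this]
    exact le_mul_of_one_le_right (sq_nonneg _) (by nlinarith)
  constructor
  · rw [show s - (1 + (s ^ 2 - 1) / 2) = -((s - 1) ^ 2 / 2) by ring, abs_neg,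
      abs_of_nonneg (by positivity)]
    linarith [sq_nonneg (s - 1)]
  · have hinv : 1 / s ≤ 2 := by rw [div_le_iff₀ (by linarith)]; linarith
    have hinv0 : 0 ≤ 1 / s := by positivity
    rw [show 1 / s - (1 - (s ^ 2 - 1) / 2) = (s - 1) ^ 2 * (1 / 2 + 1 / s) by
      field_simp; ring, abs_of_nonneg (by positivity)]
    nlinarith [sq_nonneg (s - 1)]

theorem isBigO_sqrt_one_add (κ : ℝ) :
    (fun h : ℝ => √(1 + κ * h ^ 2) - (1 + κ / 2 * h ^ 2)) =O[𝓝[≥] 0] (fun h : ℝ => h ^ 4) ∧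
    (fun h : ℝ => 1 / √(1 + κ * h ^ 2) - (1 - κ / 2 * h ^ 2)) =O[𝓝[≥] 0]
      (fun h : ℝ => h ^ 4) := by
  have hev : ∀ᶠ h : ℝ in 𝓝[≥] 0, |κ * h ^ 2| ≤ 1 / 2 := by
    have : Tendsto (fun h : ℝ => κ * h ^ 2) (𝓝[≥] 0) (𝓝 0) := by
      have hc : Continuous fun h : ℝ => κ * h ^ 2 := by fun_prop
      simpa using (hc.tendsto 0).mono_left (nhdsWithin_le_nhds (s := Ici 0))
    filter_upwards [this (Metric.closedBall_mem_nhds 0 (by norm_num : (0 : ℝ) < 1 / 2))]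
      with h hh
    rwa [mem_preimage, mem_closedBall_zero_iff, Real.norm_eq_abs] at hh
  constructor <;> refine IsBigO.of_bound (3 * κ ^ 2) ?_ <;> filter_upwards [hev] with h hh <;>
    obtain ⟨h1, h2⟩ := abs_sqrt_one_add_sub_le hh <;>
    rw [Real.norm_eq_abs, Real.norm_of_nonneg (by positivity)]
  · calc _ = |√(1 + κ * h ^ 2) - (1 + κ * h ^ 2 / 2)| := by congr 1; ring
      _ ≤ _ := h1
      _ = _ := by ring
  · calc _ = |1 / √(1 + κ * h ^ 2) - (1 - κ * h ^ 2 / 2)| := by congr 1; ring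
      _ ≤ _ := h2
      _ = _ := by ring

/-- Expansion of the argument of an IMQ-RBF stage with node `c` and shape parameter `ε`. -/
theorem isBigO_stage_argument (ε c v : ℝ) {k : ℝ → ℝ} {k₀ k₁ k₂ k₃ : ℝ}
    (hk : (fun h => k h - (k₀ + k₁ * h + k₂ * h ^ 2 + k₃ * h ^ 3)) =O[𝓝[≥] 0]
      fun h : ℝ => h ^ 4) :
    (fun h => √(1 + ε * c ^ 2 * h ^ 2) * (h * (c * k h)) + v / √(1 + ε * c ^ 2 * h ^ 2) - v -
      (c * k₀ * h + (c * k₁ - v * (ε * c ^ 2) / 2) * h ^ 2 +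
        (c * k₂ + ε * c ^ 3 / 2 * k₀) * h ^ 3 + c * k₃ * h ^ 4)) =O[𝓝[≥] 0]
      fun h : ℝ => h ^ 4 := by
  obtain ⟨hs, hi⟩ := isBigO_sqrt_one_add (ε * c ^ 2)
  have hlim {g : ℝ → ℝ} (hg : Continuous g) : Tendsto g (𝓝[≥] 0) (𝓝 (g 0)) :=
    hg.continuousWithinAt
  have hk0 : Tendsto k (𝓝[≥] 0) (𝓝 k₀) := by
    have h1 : Tendsto (fun h : ℝ => h ^ 4) (𝓝[≥] 0) (𝓝 0) := by
      convert hlim (g := fun h : ℝ => h ^ 4) (by fun_prop) using 2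
      norm_num
    have h2 := (hk.trans_tendsto h1).add
      (hlim (g := fun h => k₀ + k₁ * h + k₂ * h ^ 2 + k₃ * h ^ 3) (by fun_prop))
    simpa using h2
  have e1 := isBigO_mul_continuous hs ((hlim (g := fun h => h * c) (by fun_prop)).mul hk0)
  have e2 := isBigO_mul_continuous hi (tendsto_const_nhds (x := v))
  have e3 := isBigO_mul_continuous hk
    (hlim (g := fun h => (1 + ε * c ^ 2 / 2 * h ^ 2) * h * c) (by fun_prop))
  have e4 := isBigO_mul_continuous (isBigO_refl (fun h : ℝ => h ^ 4) (𝓝[≥] 0))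
    (hlim (g := fun h => ε * c ^ 3 / 2 * (k₁ + k₂ * h + k₃ * h ^ 2)) (by fun_prop))
  refine (((e1.add e2).add e3).add e4).congr_left fun h => ?_
  ring

end Expansion

/-- Fourth-order accuracy of the three-stage IMQ-RBF Runge–Kutta method (case IV):
`a₂₁ = c₂ = 1/2`, `a₃₁ = 0`, `a₃₂ = c₃ = 3/4`, `b₁ = 2/9`, `b₂ = 1/3`, `b₃ = 4/9`,
shape parameters
`ε₂² = ((1/3)f³ f_uuu + f² f_tuu + 4f f_u³ + f f_ttu + 4f_t f_u² + (1/3)f_ttt)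
      /(v f f_uu − 4v f_u² + v f_tu − f f_u)` and `ε₃² = −ε₂²/3` (denominator nonzero);
then the local truncation error is `O(h⁴)` as `h → 0⁺`. -/
theorem imq_rk3_fourth_order_IV
    (a b : ℝ) (hab : a < b) (f : ℝ × ℝ → ℝ) (hf : ContDiff ℝ (⊤ : ℕ∞) f)
    (u : ℝ → ℝ) (hu : ContDiffOn ℝ (⊤ : ℕ∞) u (Set.Icc a b))
    (hode : ∀ s ∈ Set.Icc a b, HasDerivWithinAt u (f (s, u s)) (Set.Icc a b) s)
    (t : ℝ) (ht : t ∈ Set.Ico a b) :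
    let v := u t
    let F := f (t, v)
    let ft := pd f (1, 0) (t, v)
    let fu := pd f (0, 1) (t, v)
    let ftu := pd (pd f (1, 0)) (0, 1) (t, v)
    let fuu := pd (pd f (0, 1)) (0, 1) (t, v)
    let fuuu := pd (pd (pd f (0, 1)) (0, 1)) (0, 1) (t, v)
    let ftuu := pd (pd (pd f (1, 0)) (0, 1)) (0, 1) (t, v)
    let fttu := pd (pd (pd f (1, 0)) (1, 0)) (0, 1) (t, v)
    let fttt := pd (pd (pd f (1, 0)) (1, 0)) (1, 0) (t, v)
    let den := v * F * fuu - 4 * v * fu ^ 2 + v * ftu - F * fu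
    let eps2 := ((1 / 3) * F ^ 3 * fuuu + F ^ 2 * ftuu + 4 * F * fu ^ 3 + F * fttu +
      4 * ft * fu ^ 2 + (1 / 3) * fttt) / den
    let eps3 := -eps2 / 3
    den ≠ 0 →
    ∃ C > 0, ∃ h₀ > 0, ∀ h : ℝ, 0 < h → h ≤ h₀ →
      let k1 := F
      let k2 := f (t + (1 / 2) * h,
        Real.sqrt (1 + eps2 * (1 / 2) ^ 2 * h ^ 2) * (h * (1 / 2) * k1) +
          v / Real.sqrt (1 + eps2 * (1 / 2) ^ 2 * h ^ 2))
      let k3 := f (t + (3 / 4) * h,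
        Real.sqrt (1 + eps3 * (3 / 4) ^ 2 * h ^ 2) * (h * (0 * k1 + (3 / 4) * k2)) +
          v / Real.sqrt (1 + eps3 * (3 / 4) ^ 2 * h ^ 2))
      |(u (t + h) - u t) / h - ((2 / 9) * k1 + (1 / 3) * k2 + (4 / 9) * k3)| ≤
        C * h ^ 4 := by
  intro v F ft fu ftu fuu fuuu ftuu fttu fttt den eps2 eps3 hden
  have hδ : 0 < b - t := sub_pos.2 ht.2
  have hmem (s : ℝ) (hs : s ∈ Icc 0 (b - t)) : t + s ∈ Icc a b :=
    ⟨by linarith [ht.1, hs.1], by linarith [hs.2]⟩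
  have hw : ∀ s ∈ Icc 0 (b - t), HasDerivWithinAt (fun s => u (t + s) - v)
      (f (t + 1 * s, v + (u (t + s) - v))) (Icc 0 (b - t)) s := by
    intro s hs
    have h1 := (hode (t + s) (hmem s hs)).comp s
      ((hasDerivAt_id s).const_add t).hasDerivWithinAt hmem
    simpa [Function.comp_def] using h1.sub_const v
  have hw0 : u (t + 0) - v = 0 := by simp [v]
  have hbdd : (fun s => f (t + 1 * s, v + (u (t + s) - v)) - (0 + 0 * s + 0 * s ^ 2 + 0 * s ^ 3))
      =O[𝓝[≥] 0] fun h : ℝ => h ^ 0 := by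
    have hc := (hw 0 ⟨le_rfl, hδ.le⟩).continuousWithinAt
    have hc' : Tendsto (fun s => u (t + s) - v) (𝓝[≥] 0) (𝓝 (u (t + 0) - v)) := by
      rwa [ContinuousWithinAt, nhdsWithin_Icc_eq_nhdsGE hδ] at hc
    have hid : Tendsto (fun s : ℝ => t + 1 * s) (𝓝[≥] 0) (𝓝 (t + 1 * 0)) :=
      (by fun_prop : Continuous fun s : ℝ => t + 1 * s).continuousWithinAt
    have hl := (hf.continuous.tendsto _).comp (hid.prodMk_nhds (hc'.const_add v))
    simpa [Function.comp_def] using hl.isBigO_one ℝ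
  have w1 := isBigO_sub_primitive hδ hw hw0 hbdd
  have w2 := isBigO_sub_primitive hδ hw hw0
    (isBigO_comp_sub_expansion hf t v 1 (by norm_num) (by norm_num) w1)
  have w3 := isBigO_sub_primitive hδ hw hw0
    (isBigO_comp_sub_expansion hf t v 1 (by norm_num) (by norm_num) w2)
  have w4 := isBigO_sub_primitive hδ hw hw0
    (isBigO_comp_sub_expansion hf t v 1 (by norm_num) (by norm_num) w3)
  have w5 := isBigO_sub_primitive hδ hw hw0
    (isBigO_comp_sub_expansion hf t v 1 (by norm_num) (by norm_num) w4)
  have a2 := isBigO_stage_argument eps2 (1 / 2) v (k := fun _ => F) (k₀ := F) (k₁ := 0) (k₂ := 0)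
    (k₃ := 0) (by simpa using isBigO_zero _ _)
  have s2 := isBigO_comp_sub_expansion hf t v (1 / 2) (by norm_num) le_rfl a2
  have s3 := isBigO_comp_sub_expansion hf t v (3 / 4) (by norm_num) le_rfl
    (isBigO_stage_argument eps3 (3 / 4) v s2)
  have hO := w5.sub (((isBigO_refl (fun h : ℝ => h) (𝓝[≥] 0)).mul
    ((s2.const_mul_left (1 / 3)).add (s3.const_mul_left (4 / 9)))).congr_right
      (g₂ := fun h => h ^ (4 + 1)) fun h => by ring)
  obtain ⟨C, hC, hb⟩ := hO.exists_pos
  obtain ⟨η, hη, hη'⟩ := mem_nhdsGE_iff_exists_Icc_subset.1 hb.bound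
  refine ⟨C, hC, η, hη, fun h h0 hle => ?_⟩
  have key := hη' (⟨h0.le, hle⟩ : h ∈ Icc 0 η)
  simp only [mem_ofPred_eq, add_sub_cancel] at key
  intro k1 k2 k3
  have hk2 : f (t + 1 / 2 * h, √(1 + eps2 * (1 / 2) ^ 2 * h ^ 2) * (h * (1 / 2 * F)) +
      v / √(1 + eps2 * (1 / 2) ^ 2 * h ^ 2)) = k2 := by
    simp only [k2, k1, mul_assoc]
  rw [hk2] at key
  have hk3 : f (t + 3 / 4 * h, √(1 + eps3 * (3 / 4) ^ 2 * h ^ 2) * (h * (3 / 4 * k2)) +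
      v / √(1 + eps3 * (3 / 4) ^ 2 * h ^ 2)) = k3 := by
    simp only [k3, zero_mul, zero_add]
  rw [hk3] at key
  have heps : eps2 * den = (1 / 3) * F ^ 3 * fuuu + F ^ 2 * ftuu + 4 * F * fu ^ 3 + F * fttu +
      4 * ft * fu ^ 2 + (1 / 3) * fttt := div_mul_cancel₀ _ hden
  have hstep : (u (t + h) - u t) - h * ((2 / 9) * k1 + (1 / 3) * k2 + (4 / 9) * k3) =
      h * ((u (t + h) - u t) / h - ((2 / 9) * k1 + (1 / 3) * k2 + (4 / 9) * k3)) := by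
    field_simp
  have hmain : |(u (t + h) - u t) - h * ((2 / 9) * k1 + (1 / 3) * k2 + (4 / 9) * k3)| ≤
      C * h ^ 5 := by
    rw [Real.norm_eq_abs, Real.norm_of_nonneg (by positivity)] at key
    convert key using 2
    have heps3 : eps3 = -eps2 / 3 := rfl
    have hk1 : k1 = F := rfl
    have hden' : den = v * F * fuu - 4 * v * fu ^ 2 + v * ftu - F * fu := rfl
    rw [hden'] at heps
    rw [heps3, hk1]
    clear_value eps2 k2 k3
    simp only [v, F, ft, fu, ftu, fuu, fuuu, ftuu, fttu, fttt] at heps ⊢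
    linear_combination (-(h ^ 4) / 96) * heps
  rw [hstep, abs_mul, abs_of_pos h0] at hmain
  refine le_of_mul_le_mul_left (hmain.trans_eq ?_) h0
  ring
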